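/- If f, h, g, l ∈ 𝒫 satisfy the four equations f′ − k₁h + k₂l = 0, a·f + h′ − ε₁k₁g = 0, ε₁·a·h + g′ = 0 and l′ + ε₂k₂g = 0, then f = h = g = l = 0. -/

import Mathlib

noncomputable section
open MvPolynomial

/-- The differential algebra `𝒫`: polynomials in `k₁⁽ᵐ⁾ = X (0, m)` and `k₂⁽ᵐ⁾ = X (1, m)`. -/
abbrev PP : Type := MvPolynomial (Fin 2 × ℕ) ℝ

/-- The derivation `f ↦ f′` with `D (kᵢ⁽ᵐ⁾) = kᵢ⁽ᵐ⁺¹⁾`. -/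
def Dx : Derivation ℝ PP PP :=
  MvPolynomial.mkDerivation ℝ (fun im : Fin 2 × ℕ => MvPolynomial.X (im.1, im.2 + 1))

def k1 : PP := MvPolynomial.X (0, 0)
def k2 : PP := MvPolynomial.X (1, 0)

/-- A `𝒫`-local vector field: a quadruple `(f, h, g, l) ∈ 𝒫⁴`. -/
structure LVF where
  f : PP
  h : PP
  g : PP
  l : PP

namespace LVF

instance : Zero LVF := ⟨⟨0, 0, 0, 0⟩⟩
instance : Neg LVF := ⟨fun U => ⟨-U.f, -U.h, -U.g, -U.l⟩⟩
instance : Add LVF := ⟨fun U W => ⟨U.f + W.f, U.h + W.h, U.g + W.g, U.l + W.l⟩⟩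
instance : Sub LVF := ⟨fun U W => ⟨U.f - W.f, U.h - W.h, U.g - W.g, U.l - W.l⟩⟩

def phi (a ε₁ : ℝ) (V : LVF) : PP := C a * V.f + Dx V.h - C ε₁ * k1 * V.g

def psi (ε₂ : ℝ) (V : LVF) : PP := Dx V.l + C ε₂ * k2 * V.g

def rho (a ε₁ : ℝ) (V : LVF) : PP :=
  - C a * Dx V.f + C (2 * a) * k1 * V.h - C a * k2 * V.l
    - Dx (phi a ε₁ V) + C ε₁ * k1 * Dx V.g

/-- Membership in `𝔛*`: `g_V′ = −ε₁·a·h_V`. -/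
def isStar (a ε₁ : ℝ) (V : LVF) : Prop := Dx V.g = - C (ε₁ * a) * V.h

def alpha (a ε₁ : ℝ) (V : LVF) : PP :=
  C (1 / a) * (Dx (phi a ε₁ V) + C (1 / 2) * rho a ε₁ V)

def beta (a ε₁ ε₂ G : ℝ) (V : LVF) : PP :=
  C (1 / a) * (Dx (alpha a ε₁ V) + k1 * phi a ε₁ V - k2 * psi ε₂ V - C G * V.g)

def delta (a ε₁ ε₂ : ℝ) (V : LVF) : PP :=
  C (1 / a) * Dx (Dx (psi ε₂ V)) + k1 * psi ε₂ V + C (ε₁ * ε₂) * k2 * phi a ε₁ V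

/-- The value `V̂(k₁)`. -/
def vk1 (a ε₁ ε₂ G : ℝ) (V : LVF) : PP :=
  C (1 / a ^ 2) * Dx (Dx (Dx (phi a ε₁ V)))
    + C (1 / a) * (Dx (k1 * phi a ε₁ V) + k1 * Dx (phi a ε₁ V))
    - C (1 / a) * (Dx (k2 * psi ε₂ V) + k2 * Dx (psi ε₂ V))
    + C (1 / a) * (C (1 / (2 * a)) * Dx (Dx (rho a ε₁ V)) + k1 * rho a ε₁ V
        - C (2 * G) * Dx V.g)

/-- The value `V̂(k₂)`. -/
def vk2 (a ε₁ ε₂ G : ℝ) (V : LVF) : PP :=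
  C (ε₁ * ε₂ / a ^ 2) * Dx (Dx (Dx (psi ε₂ V)))
    + C (ε₁ * ε₂ / a) * (Dx (k1 * psi ε₂ V) + k1 * Dx (psi ε₂ V))
    + C (1 / a) * (Dx (k2 * phi a ε₁ V) + k2 * Dx (phi a ε₁ V))
    + C (1 / a) * (k2 * rho a ε₁ V) - C (ε₂ * G) * V.l

/-- Values of `V̂` on the generators, defined by the recursion
`V̂(kᵢ⁽ᵐ⁺¹⁾) = (V̂(kᵢ⁽ᵐ⁾))′ + (1/(2a))·ρ_V·kᵢ⁽ᵐ⁺¹⁾`. -/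
def vhatFun (a ε₁ ε₂ G : ℝ) (V : LVF) : Fin 2 × ℕ → PP := fun im =>
  Nat.rec (motive := fun _ => PP)
    (if im.1 = 0 then vk1 a ε₁ ε₂ G V else vk2 a ε₁ ε₂ G V)
    (fun m prev => Dx prev + C (1 / (2 * a)) * rho a ε₁ V * MvPolynomial.X (im.1, m + 1))
    im.2

/-- The derivation `V̂` attached to `V ∈ 𝔛*`. -/
def vhat (a ε₁ ε₂ G : ℝ) (V : LVF) : Derivation ℝ PP PP :=
  MvPolynomial.mkDerivation ℝ (vhatFun a ε₁ ε₂ G V)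

/-- The operator `D_V U`. -/
def DV (a ε₁ ε₂ G : ℝ) (V U : LVF) : LVF where
  f := vhat a ε₁ ε₂ G V U.f - alpha a ε₁ V * U.f - beta a ε₁ ε₂ G V * U.h
        + C (ε₁ * ε₂ / a) * delta a ε₁ ε₂ V * U.l
  h := vhat a ε₁ ε₂ G V U.h + phi a ε₁ V * U.f - C ε₁ * beta a ε₁ ε₂ G V * U.g
        - C (ε₁ * ε₂ / a) * Dx (psi ε₂ V) * U.l
  g := vhat a ε₁ ε₂ G V U.g + C ε₁ * phi a ε₁ V * U.h + alpha a ε₁ V * U.g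
        + C ε₂ * psi ε₂ V * U.l
  l := vhat a ε₁ ε₂ G V U.l + psi ε₂ V * U.f + C (1 / a) * Dx (psi ε₂ V) * U.h
        + C (ε₁ / a) * delta a ε₁ ε₂ V * U.g

/-- The bracket `[V₁, V₂] = D_{V₁}V₂ − D_{V₂}V₁`. -/
def bracket (a ε₁ ε₂ G : ℝ) (V₁ V₂ : LVF) : LVF :=
  DV a ε₁ ε₂ G V₁ V₂ - DV a ε₁ ε₂ G V₂ V₁

end LVF

/-- `∂/∂kᵢ⁽ᵐ⁺¹⁾` and `D` commute up to `∂/∂kᵢ⁽ᵐ⁾`. -/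
theorem pderiv_succ_Dx (i : Fin 2) (m : ℕ) (p : PP) :
    pderiv (i, m + 1) (Dx p) = Dx (pderiv (i, m + 1) p) + pderiv (i, m) p := by
  have key : ⁅pderiv (R := ℝ) (i, m + 1), Dx⁆ = pderiv (i, m) := by
    refine derivation_ext fun j => ?_
    classical
    rw [Derivation.commutator_apply]
    simp [Dx, mkDerivation_X, pderiv_X, Pi.single_apply, Prod.ext_iff, apply_ite]
  rw [← key, Derivation.commutator_apply]
  ring

/-- A differential polynomial is killed by all partial derivatives of large enough order. -/
theorem exists_forall_pderiv_eq_zero (p : PP) :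
    ∃ N : ℕ, ∀ (i : Fin 2) (m : ℕ), N ≤ m → pderiv (i, m) p = 0 := by
  refine ⟨p.vars.sup Prod.snd + 1, fun i m hm => pderiv_eq_zero_of_notMem_vars fun h => ?_⟩
  have := Finset.le_sup (f := Prod.snd) h
  simp only at this
  omega

/-- A differential polynomial with vanishing partial derivatives has vanishing derivative. -/
theorem Dx_eq_zero_of_pderiv_eq_zero {p : PP} (hp : ∀ j, pderiv j p = 0) : Dx p = 0 := by
  classical
  have hconst : p = C (coeff 0 p) := by
    ext s
    rw [coeff_C]
    split_ifs with hs
    · rw [hs]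
    · obtain ⟨j, hj⟩ := Finsupp.ne_iff.mp (Ne.symm hs)
      have hle : Finsupp.single j 1 ≤ s :=
        Finsupp.single_le_iff.mpr (Nat.one_le_iff_ne_zero.mpr hj)
      have hc := coeff_pderiv (i := j) p (s - Finsupp.single j 1)
      rw [hp j, coeff_zero, tsub_add_cancel_of_le hle] at hc
      exact (mul_eq_zero.mp hc.symm).resolve_right (Nat.cast_add_one_ne_zero _)
  rw [hconst, derivation_C]

/-- If `D` does not raise the order of `p` above `n`, then `p` has order less than `n`. -/
theorem pderiv_eq_zero_of_Dx {p : PP} {n : ℕ}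
    (hp : ∀ (i : Fin 2) (m : ℕ), n + 1 ≤ m → pderiv (i, m) p = 0)
    (hD : ∀ (i : Fin 2) (m : ℕ), n + 1 ≤ m → pderiv (i, m) (Dx p) = 0)
    (i : Fin 2) (m : ℕ) (hm : n ≤ m) : pderiv (i, m) p = 0 := by
  have h := pderiv_succ_Dx i m p
  rw [hD i _ (by omega), hp i _ (by omega), map_zero, zero_add] at h
  exact h.symm

theorem pderiv_succ_k1 (i : Fin 2) {m : ℕ} (hm : 1 ≤ m) : pderiv (i, m) k1 = 0 := by
  refine pderiv_X_of_ne fun h => ?_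
  simp only [Prod.mk.injEq] at h
  omega

theorem pderiv_succ_k2 (i : Fin 2) {m : ℕ} (hm : 1 ≤ m) : pderiv (i, m) k2 = 0 := by
  refine pderiv_X_of_ne fun h => ?_
  simp only [Prod.mk.injEq] at h
  omega

/-- The only solution in `𝒫` of the system
`f′ − k₁h + k₂l = 0`, `a f + h′ − ε₁k₁g = 0`, `ε₁ a h + g′ = 0`, `l′ + ε₂k₂g = 0`
is the trivial one. -/
theorem stmt17 (a ε₁ ε₂ : ℝ) (ha : a ≠ 0) (hε₁ : ε₁ = 1 ∨ ε₁ = -1)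
    (hε₂ : ε₂ = 1 ∨ ε₂ = -1) (f h g l : PP)
    (e1 : Dx f - k1 * h + k2 * l = 0)
    (e2 : MvPolynomial.C a * f + Dx h - MvPolynomial.C ε₁ * k1 * g = 0)
    (e3 : MvPolynomial.C (ε₁ * a) * h + Dx g = 0)
    (e4 : Dx l + MvPolynomial.C ε₂ * k2 * g = 0) :
    f = 0 ∧ h = 0 ∧ g = 0 ∧ l = 0 := by
  have d1 : Dx f = k1 * h - k2 * l := by linear_combination e1
  have d2 : Dx h = C ε₁ * k1 * g - C a * f := by linear_combination e2
  have d3 : Dx g = - (C (ε₁ * a) * h) := by linear_combination e3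
  have d4 : Dx l = - (C ε₂ * k2 * g) := by linear_combination e4
  have descent : ∀ n : ℕ, (∀ (i : Fin 2) (m : ℕ), n ≤ m → pderiv (i, m) f = 0 ∧
      pderiv (i, m) h = 0 ∧ pderiv (i, m) g = 0 ∧ pderiv (i, m) l = 0) →
      Dx f = 0 ∧ Dx h = 0 ∧ Dx g = 0 ∧ Dx l = 0 := by
    intro n
    induction n with
    | zero =>
      intro H
      exact ⟨Dx_eq_zero_of_pderiv_eq_zero fun j => (H j.1 j.2 j.2.zero_le).1,
        Dx_eq_zero_of_pderiv_eq_zero fun j => (H j.1 j.2 j.2.zero_le).2.1,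
        Dx_eq_zero_of_pderiv_eq_zero fun j => (H j.1 j.2 j.2.zero_le).2.2.1,
        Dx_eq_zero_of_pderiv_eq_zero fun j => (H j.1 j.2 j.2.zero_le).2.2.2⟩
    | succ n ih =>
      refine fun H => ih fun i m hm => ⟨?_, ?_, ?_, ?_⟩
      all_goals
        refine pderiv_eq_zero_of_Dx (n := n) (fun i m hm => by simp [H i m hm])
          (fun i m hm => ?_) i m hm
        have hm1 : 1 ≤ m := by omega
        simp [d1, d2, d3, d4, H i m hm, pderiv_succ_k1 i hm1, pderiv_succ_k2 i hm1]
  obtain ⟨Nf, hf⟩ := exists_forall_pderiv_eq_zero f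
  obtain ⟨Nh, hh⟩ := exists_forall_pderiv_eq_zero h
  obtain ⟨Ng, hg⟩ := exists_forall_pderiv_eq_zero g
  obtain ⟨Nl, hl⟩ := exists_forall_pderiv_eq_zero l
  obtain ⟨z1, z2, z3, z4⟩ := descent (Nf + Nh + Ng + Nl) fun i m hm =>
    ⟨hf i m (by omega), hh i m (by omega), hg i m (by omega), hl i m (by omega)⟩
  have hk2 : k2 ≠ 0 := X_ne_zero _
  have hε₁0 : ε₁ ≠ 0 := by rcases hε₁ with rfl | rfl <;> norm_num
  have hε₂0 : ε₂ ≠ 0 := by rcases hε₂ with rfl | rfl <;> norm_num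
  have h0 : h = 0 := by simpa [z3, ha, hε₁0] using e3
  have g0 : g = 0 := by simpa [z4, hk2, hε₂0] using e4
  have f0 : f = 0 := by simpa [z2, g0, ha] using e2
  have l0 : l = 0 := by simpa [z1, h0, hk2] using e1
  exact ⟨f0, h0, g0, l0⟩
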